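/- Let f : ℝ^k → ℝ be continuous with |f(x)| ≤ a + K·φ(|x|) for all x, where a ≥ 0, K > 0 are constants and φ : [0,∞) → [0,∞) is a strictly increasing convex function with φ(0) = 0 and φ continuous at 0. For n ≥ 1 define f^n(x) = sup { f(u) − (n/2)·K·φ(2|u − x|) : u ∈ ℚ^k }. Then f^n is well-defined (the supremum is finite for every x), satisfies |f^n(x)| ≤ a + (1/2)·K·φ(2|x|) and f^n(x) ≥ f(x) for all x, the sequence (f^n) is nonincreasing in n, and f^n(x) → f(x) as n → ∞ for every x ∈ ℝ^k. -/

import Mathlib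

open Filter

/-- The set of points of `ℝ^k` with rational coordinates. -/
def ratPoints (k : ℕ) : Set (EuclideanSpace ℝ (Fin k)) :=
  {u | ∀ i, ∃ r : ℚ, u i = (r : ℝ)}

/-- The approximating supremal convolution `f^n`. -/
noncomputable def upperApprox {k : ℕ} (f : EuclideanSpace ℝ (Fin k) → ℝ)
    (K : ℝ) (φ : ℝ → ℝ) (n : ℕ) (x : EuclideanSpace ℝ (Fin k)) : ℝ :=
  sSup ((fun u => f u - ((n : ℝ) / 2) * K * φ (2 * ‖u - x‖)) '' ratPoints k)

theorem dense_ratPoints (k : ℕ) : Dense (ratPoints k) := by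
  have h : DenseRange (Pi.map fun (_ : Fin k) (r : ℚ) => (r : ℝ)) :=
    DenseRange.piMap fun _ => Rat.denseRange_cast
  have h' := (EuclideanSpace.equiv (Fin k) ℝ).symm.surjective.denseRange.comp h
    (EuclideanSpace.equiv (Fin k) ℝ).symm.continuous
  refine Dense.mono ?_ h'
  rintro _ ⟨r, rfl⟩ i
  exact ⟨r i, rfl⟩

/-- A nondecreasing convex function of the norm satisfies a halved triangle inequality. -/
theorem ConvexOn.map_norm_le_half_add_half {E : Type*} [SeminormedAddCommGroup E] {φ : ℝ → ℝ}
    (hconv : ConvexOn ℝ (Set.Ici (0 : ℝ)) φ) (hmono : MonotoneOn φ (Set.Ici (0 : ℝ))) (u x : E) :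
    φ ‖u‖ ≤ (1 / 2) * φ (2 * ‖u - x‖) + (1 / 2) * φ (2 * ‖x‖) := by
  have hu : (0 : ℝ) ≤ 2 * ‖u - x‖ := by positivity
  have hx : (0 : ℝ) ≤ 2 * ‖x‖ := by positivity
  have hc := hconv.2 (Set.mem_Ici.2 hu) (Set.mem_Ici.2 hx)
    (by norm_num : (0 : ℝ) ≤ 1 / 2) (by norm_num : (0 : ℝ) ≤ 1 / 2) (by norm_num)
  simp only [smul_eq_mul] at hc
  refine le_trans (hmono (norm_nonneg u) (Set.mem_Ici.2 (by positivity)) ?_) hc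
  have := norm_add_le (u - x) x
  rw [sub_add_cancel] at this
  linarith

/-- A function that is continuous at `x` is bounded at `x` by any upper bound of its values on a
dense set. -/
theorem Dense.le_of_continuousAt {X : Type*} [TopologicalSpace X] {s : Set X} (hs : Dense s)
    {g : X → ℝ} {x : X} (hg : ContinuousAt g x) {b : ℝ} (hb : ∀ u ∈ s, g u ≤ b) : g x ≤ b :=
  have hsub : g '' s ⊆ Set.Iic b := Set.image_subset_iff.2 hb
  closure_minimal hsub isClosed_Iic (mem_closure_image hg (hs x))

/-- `f^n` is well-defined, `|f^n x| ≤ a + (1/2) K φ(2|x|)`,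
`f^n x ≥ f x`, the sequence `(f^n)` is nonincreasing in `n`, and `f^n x → f x`. -/
theorem upperApprox_properties
    (k : ℕ) (hk : 1 ≤ k)
    (f : EuclideanSpace ℝ (Fin k) → ℝ) (hf : Continuous f)
    (a K : ℝ) (ha : 0 ≤ a) (hK : 0 < K)
    (φ : ℝ → ℝ)
    (hφ_nonneg : ∀ t ∈ Set.Ici (0 : ℝ), 0 ≤ φ t)
    (hφ_mono : StrictMonoOn φ (Set.Ici (0 : ℝ)))
    (hφ_conv : ConvexOn ℝ (Set.Ici (0 : ℝ)) φ)
    (hφ_zero : φ 0 = 0)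
    (hφ_cont : ContinuousWithinAt φ (Set.Ici (0 : ℝ)) 0)
    (hbound : ∀ x, |f x| ≤ a + K * φ ‖x‖)
    (x : EuclideanSpace ℝ (Fin k)) :
    (∀ n : ℕ, 1 ≤ n →
        BddAbove ((fun u => f u - ((n : ℝ) / 2) * K * φ (2 * ‖u - x‖)) '' ratPoints k)) ∧
    (∀ n : ℕ, 1 ≤ n → |upperApprox f K φ n x| ≤ a + (1 / 2) * K * φ (2 * ‖x‖)) ∧
    (∀ n : ℕ, 1 ≤ n → f x ≤ upperApprox f K φ n x) ∧
    (∀ n : ℕ, 1 ≤ n → upperApprox f K φ (n + 1) x ≤ upperApprox f K φ n x) ∧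
    Tendsto (fun n => upperApprox f K φ n x) atTop (nhds (f x)) := by
  have hmono := hφ_mono.monotoneOn
  have hne : (ratPoints k).Nonempty := (dense_ratPoints k).nonempty
  have hφ2 (u : EuclideanSpace ℝ (Fin k)) : 0 ≤ φ (2 * ‖u - x‖) :=
    hφ_nonneg _ (Set.mem_Ici.2 (by positivity))
  have hval (n : ℕ) (u : EuclideanSpace ℝ (Fin k)) :
      f u - ((n : ℝ) / 2) * K * φ (2 * ‖u - x‖) ≤
        a + (1 / 2) * K * φ (2 * ‖x‖) - (((n : ℝ) - 1) / 2) * K * φ (2 * ‖u - x‖) := by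
    have h1 := (abs_le.1 (hbound u)).2
    have h2 := mul_le_mul_of_nonneg_left (hφ_conv.map_norm_le_half_add_half hmono u x) hK.le
    linarith
  have hupper (n : ℕ) (hn : 1 ≤ n) (u : EuclideanSpace ℝ (Fin k)) :
      f u - ((n : ℝ) / 2) * K * φ (2 * ‖u - x‖) ≤ a + (1 / 2) * K * φ (2 * ‖x‖) := by
    have hn' : (0 : ℝ) ≤ (n : ℝ) - 1 := sub_nonneg.2 (by exact_mod_cast hn)
    have : 0 ≤ (((n : ℝ) - 1) / 2) * K * φ (2 * ‖u - x‖) :=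
      mul_nonneg (by positivity) (hφ2 u)
    linarith [hval n u]
  have hbdd (n : ℕ) (hn : 1 ≤ n) :
      BddAbove ((fun u => f u - ((n : ℝ) / 2) * K * φ (2 * ‖u - x‖)) '' ratPoints k) :=
    ⟨_, Set.forall_mem_image.2 fun u _ => hupper n hn u⟩
  have hcont : ContinuousAt (fun u => φ (2 * ‖u - x‖)) x := by
    have h0 : Tendsto (fun u => 2 * ‖u - x‖) (nhds x) (nhdsWithin 0 (Set.Ici 0)) := by
      refine tendsto_nhdsWithin_iff.2
        ⟨?_, Eventually.of_forall fun u => Set.mem_Ici.2 (by positivity)⟩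
      have : Continuous fun u : EuclideanSpace ℝ (Fin k) => 2 * ‖u - x‖ := by fun_prop
      simpa using this.tendsto x
    have h1 := hφ_cont.tendsto.comp h0
    simpa [ContinuousAt, Function.comp_def] using h1
  have hlower (n : ℕ) (hn : 1 ≤ n) : f x ≤ upperApprox f K φ n x := by
    have hg : ContinuousAt (fun u => f u - ((n : ℝ) / 2) * K * φ (2 * ‖u - x‖)) x :=
      hf.continuousAt.sub (hcont.const_mul _)
    have := (dense_ratPoints k).le_of_continuousAt hg (b := upperApprox f K φ n x)
      fun u hu => le_csSup (hbdd n hn) (Set.mem_image_of_mem _ hu)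
    simpa [hφ_zero] using this
  refine ⟨hbdd, fun n hn => abs_le.2 ⟨?_, ?_⟩, hlower, fun n hn => ?_, ?_⟩
  · have h1 := (abs_le.1 (hbound x)).1
    have h2 := mul_le_mul_of_nonneg_left (hφ_conv.map_norm_le_half_add_half hmono x 0) hK.le
    have h3 := mul_le_mul_of_nonneg_left (hφ_conv.map_norm_le_half_add_half hmono x x) hK.le
    rw [sub_self, norm_zero, mul_zero, hφ_zero] at h3
    linarith [hlower n hn]
  · exact csSup_le (hne.image _) (Set.forall_mem_image.2 fun u _ => hupper n hn u)
  · refine csSup_le (hne.image _) (Set.forall_mem_image.2 fun u hu => ?_)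
    refine le_trans ?_ (le_csSup (hbdd n hn) (Set.mem_image_of_mem _ hu))
    have := mul_nonneg hK.le (hφ2 u)
    push_cast
    linarith
  · rw [Metric.tendsto_atTop]
    intro ε hε
    obtain ⟨δ, hδ, hfδ⟩ := Metric.continuousAt_iff.1 hf.continuousAt (ε / 2) (half_pos hε)
    have hφδ : 0 < φ (2 * δ) := by
      rw [← hφ_zero]
      exact hφ_mono Set.self_mem_Ici (Set.mem_Ici.2 (by positivity)) (by positivity)
    obtain ⟨N, hN⟩ := exists_nat_ge
      ((a + (1 / 2) * K * φ (2 * ‖x‖) - f x) / (K * φ (2 * δ) / 2))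
    refine ⟨N + 1, fun n hn => ?_⟩
    have hle : upperApprox f K φ n x ≤ f x + ε / 2 := by
      refine csSup_le (hne.image _) (Set.forall_mem_image.2 fun u _ => ?_)
      rcases lt_or_ge ‖u - x‖ δ with h | h
      · have h1 := hfδ (by rwa [dist_eq_norm])
        rw [Real.dist_eq] at h1
        have h2 : 0 ≤ ((n : ℝ) / 2) * K * φ (2 * ‖u - x‖) := mul_nonneg (by positivity) (hφ2 u)
        linarith [(abs_lt.1 h1).2]
      · have h1 : φ (2 * δ) ≤ φ (2 * ‖u - x‖) :=
          hmono (Set.mem_Ici.2 (by positivity)) (Set.mem_Ici.2 (by positivity)) (by linarith)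
        have h2 : (N : ℝ) ≤ (n : ℝ) - 1 := le_sub_iff_add_le.2 (by exact_mod_cast hn)
        rw [div_le_iff₀ (by positivity)] at hN
        have h3 : (N : ℝ) * (K * φ (2 * δ) / 2) ≤ ((n : ℝ) - 1) * (K * φ (2 * ‖u - x‖) / 2) :=
          mul_le_mul h2 (by gcongr) (by positivity) ((Nat.cast_nonneg N).trans h2)
        linarith [hval n u]
    rw [Real.dist_eq, abs_lt]
    constructor <;> linarith [hlower n (by omega)]
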